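/- arXiv:1902.11163 — 2 statements merged into one kernel-verified Lean document; each statement's English description precedes it below -/
import Mathlib

section
/- Let f_1,…,f_N : ℝ^d → ℝ each be μ-strongly convex and differentiable with L-Lipschitz gradient, with κ = L/μ ≥ 2, and let x* minimize F(z) = Σ_{i=1}^N f_i(z). Consider the quantized iteration with E = ℝ^d and the Euclidean norm, A(c,x) = x − γ Σ_{i=1}^N c_i, C_i(x) = ∇f_i(x), γ = 2/(N(μ+L)), σ = 1 − 2/(κ+1), L_A = γN√d, L_C = L, constants K, α(b), r^k as in the setup, and b = ⌈log₂(24(κ+1)√d)⌉. Then α(b) < 1 with 1/(1 − α(b)) ≤ κ + 1; consequently, for any ε > 0 and every integer k ≥ (κ+1) log(D/ε), one has ‖x^k − x*‖₂ ≤ ε, so an ε-accurate solution is reached after each node has communicated at most ⌈log₂(24(κ+1)√d)⌉ · d · (κ+1) · log(D/ε) bits. -/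
/-- The adaptive quantizer: projects `c` onto a uniform grid of radius `r`
(in the sup norm) centered at `q`, with `2^b` points per dimension. -/
noncomputable def quant {d : ℕ} (c q : Fin d → ℝ) (r : ℝ) (b : ℕ) : Fin d → ℝ :=
  fun j =>
    let δ : ℝ := r / (2 ^ b - 1)
    if q j ≤ c j - r + δ then q j - r
    else if c j + r - δ ≤ q j then q j + r
    else q j - r + 2 * δ * (⌊(c j - q j + r + δ) / (2 * δ)⌋ : ℝ)

section QuantHelpers

/-- In the interior of the grid the quantizer has error at most `δ`. -/
theorem quant_error {d : ℕ} (c q : Fin d → ℝ) (r : ℝ) (b : ℕ)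
    (hδ : 0 < r / (2 ^ b - 1)) (j : Fin d)
    (h : |c j - q j| < r - r / (2 ^ b - 1)) :
    |quant c q r b j - c j| ≤ r / (2 ^ b - 1) := by
  obtain ⟨h1, h2⟩ := abs_lt.1 h
  unfold quant
  simp only
  set δ : ℝ := r / (2 ^ b - 1) with hδd
  rw [if_neg (by linarith), if_neg (by linarith)]
  set t : ℝ := (c j - q j + r + δ) / (2 * δ) with ht
  have ht' : 2 * δ * t = c j - q j + r + δ := by
    rw [ht]; field_simp
  have f1 := mul_le_mul_of_nonneg_left (Int.floor_le t) (by linarith : (0:ℝ) ≤ 2 * δ)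
  have f2 := mul_le_mul_of_nonneg_left (Int.lt_floor_add_one t).le (by linarith : (0:ℝ) ≤ 2 * δ)
  rw [abs_le]
  constructor <;> nlinarith

variable {E : Type*} [NormedAddCommGroup E] [InnerProductSpace ℝ E] [CompleteSpace E]

theorem line_deriv (f : E → ℝ) (g : E → E)
    (hg : ∀ x, HasGradientAt f (g x) x) (x w : E) (t : ℝ) :
    HasDerivAt (fun s : ℝ => f (x + s • w)) (inner ℝ (g (x + t • w)) w) t := by
  have h1 : HasDerivAt (fun s : ℝ => x + s • w) w t := by
    simpa using ((hasDerivAt_id t).smul_const w).const_add x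
  have h2 := (hg (x + t • w)).hasFDerivAt
  have h3 := h2.comp_hasDerivAt t h1
  rw [InnerProductSpace.toDual_apply_apply] at h3
  exact h3

theorem convex_lower (f : E → ℝ) (g : E → E)
    (hg : ∀ x, HasGradientAt f (g x) x) (hf : ConvexOn ℝ Set.univ f) (x y : E) :
    f x + inner ℝ (g x) (y - x) ≤ f y := by
  have hl := line_deriv f g hg x (y - x) 0
  have hc : ConvexOn ℝ Set.univ (fun s : ℝ => f (x + s • (y - x))) := by
    have := hf.comp_affineMap (AffineMap.lineMap x y : ℝ →ᵃ[ℝ] E)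
    have e : (f ∘ (AffineMap.lineMap x y : ℝ →ᵃ[ℝ] E)) = fun s : ℝ => f (x + s • (y - x)) := by
      funext s
      simp [AffineMap.lineMap_apply, add_comm]
    rw [e] at this
    exact this
  have := hc.le_slope_of_hasDerivAt (Set.mem_univ 0) (Set.mem_univ 1) one_pos hl
  simp [slope] at this
  linarith

theorem descent (f : E → ℝ) (g : E → E) (L : ℝ)
    (hg : ∀ x, HasGradientAt f (g x) x)
    (hlip : ∀ x y, ‖g x - g y‖ ≤ L * ‖x - y‖) (x y : E) :
    f y ≤ f x + inner ℝ (g x) (y - x) + L / 2 * ‖y - x‖ ^ 2 := by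
  set w := y - x with hw
  let h : ℝ → ℝ := fun t => f (x + t • w) - t * inner ℝ (g x) w - t ^ 2 * (L / 2 * ‖w‖ ^ 2)
  have hd : ∀ t, HasDerivAt h (inner ℝ (g (x + t • w)) w - inner ℝ (g x) w
      - 2 * t * (L / 2 * ‖w‖ ^ 2)) t := by
    intro t
    have h1 := line_deriv f g hg x w t
    have h2 : HasDerivAt (fun s : ℝ => s * inner ℝ (g x) w) (inner ℝ (g x) w) t := by
      simpa using (hasDerivAt_id t).mul_const (inner ℝ (g x) w)
    have h3 : HasDerivAt (fun s : ℝ => s ^ 2 * (L / 2 * ‖w‖ ^ 2)) (2 * t * (L / 2 * ‖w‖ ^ 2)) t := by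
      simpa using (hasDerivAt_pow 2 t).mul_const (L / 2 * ‖w‖ ^ 2)
    exact (h1.sub h2).sub h3
  have hanti : AntitoneOn h (Set.Icc 0 1) := by
    apply antitoneOn_of_deriv_nonpos (convex_Icc 0 1)
    · exact fun t _ => (hd t).continuousAt.continuousWithinAt
    · exact fun t _ => (hd t).differentiableAt.differentiableWithinAt
    · intro t ht
      rw [interior_Icc] at ht
      rw [(hd t).deriv, ← inner_sub_left]
      have h1 := real_inner_le_norm (g (x + t • w) - g x) w
      have h2 := hlip (x + t • w) x
      rw [add_sub_cancel_left, norm_smul, Real.norm_of_nonneg ht.1.le] at h2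
      nlinarith [norm_nonneg w, mul_le_mul_of_nonneg_right h2 (norm_nonneg w)]
  have := hanti (Set.left_mem_Icc.2 zero_le_one) (Set.right_mem_Icc.2 zero_le_one) zero_le_one
  simp [h, hw] at this
  linarith

theorem contraction (f : E → ℝ) (g : E → E) (μ L : ℝ) (hμL : μ < L)
    (hg : ∀ x, HasGradientAt f (g x) x)
    (hconv : ConvexOn ℝ Set.univ (fun x => f x - μ / 2 * ‖x‖ ^ 2))
    (hlip : ∀ x y, ‖g x - g y‖ ≤ L * ‖x - y‖) (x y : E) :
    ‖(μ + L) • (x - y) - (2:ℝ) • (g x - g y)‖ ≤ (L - μ) * ‖x - y‖ := by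
  set M := L - μ with hM
  have hM0 : 0 < M := by linarith
  let φ : E → ℝ := fun x => f x - μ / 2 * ‖x‖ ^ 2
  let p : E → E := fun x => g x - μ • x
  have hp : ∀ x, HasGradientAt φ (p x) x := by
    intro x
    rw [hasGradientAt_iff_hasFDerivAt]
    have h1 := (hg x).hasFDerivAt
    have h2 := ((hasStrictFDerivAt_norm_sq x).hasFDerivAt).const_mul (μ / 2)
    refine (h1.sub h2).congr_fderiv ?_
    ext z
    simp [p, inner_sub_left, inner_smul_left]
    ring
  have hlow := convex_lower φ p hp hconv
  have hup : ∀ a b, φ b ≤ φ a + inner ℝ (p a) (b - a) + M / 2 * ‖b - a‖ ^ 2 := by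
    intro a b
    have := descent f g L hg hlip a b
    have e := norm_sub_sq_real b a
    have e2 := real_inner_comm a b
    have e3 := real_inner_self_eq_norm_sq a
    clear hlow
    simp only [φ, p, inner_sub_left, inner_sub_right, inner_smul_left, conj_trivial] at this ⊢
    rw [e, e2] at this
    rw [hM, e, e2, e3]
    linarith
  have key : ∀ a b, φ a + inner ℝ (p a) (b - a) + 1 / (2 * M) * ‖p a - p b‖ ^ 2 ≤ φ b := by
    intro a b
    have h1 := hlow a (b + (1 / M) • (p a - p b))
    have h2 := hup b (b + (1 / M) • (p a - p b))
    have e1 : b + (1 / M) • (p a - p b) - a = (b - a) + (1 / M) • (p a - p b) := by abel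
    rw [e1, inner_add_right, inner_smul_right] at h1
    rw [add_sub_cancel_left, inner_smul_right, norm_smul, mul_pow, Real.norm_eq_abs, sq_abs] at h2
    have e2 : inner ℝ (p a) (p a - p b) - inner ℝ (p b) (p a - p b) = ‖p a - p b‖ ^ 2 := by
      rw [← inner_sub_left, real_inner_self_eq_norm_sq]
    have e3 : M / 2 * ((1 / M) ^ 2 * ‖p a - p b‖ ^ 2) = 1 / (2 * M) * ‖p a - p b‖ ^ 2 := by
      field_simp
    have e4 : 1 / M * inner ℝ (p a) (p a - p b) - 1 / M * inner ℝ (p b) (p a - p b)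
        = 2 * (1 / (2 * M) * ‖p a - p b‖ ^ 2) := by
      rw [← mul_sub, e2]; field_simp
    linarith
  have k1 := key x y
  have k2 := key y x
  have hco : ‖p x - p y‖ ^ 2 ≤ M * inner ℝ (p x - p y) (x - y) := by
    rw [norm_sub_rev (p y) (p x)] at k2
    have e : inner ℝ (p x - p y) (x - y) = - inner ℝ (p x) (y - x) - inner ℝ (p y) (x - y) := by
      rw [inner_sub_left, ← neg_sub x y, inner_neg_right]; ring
    have e5 : M * (2 * (1 / (2 * M) * ‖p x - p y‖ ^ 2)) = ‖p x - p y‖ ^ 2 := by field_simp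
    rw [e, ← e5]
    apply mul_le_mul_of_nonneg_left _ hM0.le
    linarith
  set u := x - y with hu
  set v := g x - g y with hv
  have ep : p x - p y = v - μ • u := by
    simp only [p, hu, hv, smul_sub]; abel
  clear_value u v
  rw [ep, norm_sub_sq_real, inner_sub_left, inner_smul_right, inner_smul_left,
    real_inner_self_eq_norm_sq, norm_smul, mul_pow, Real.norm_eq_abs, sq_abs] at hco
  simp only [conj_trivial] at hco
  apply abs_le_of_sq_le_sq' _ (by positivity) |>.2
  rw [norm_sub_sq_real, inner_smul_right, inner_smul_left, norm_smul, norm_smul, mul_pow, mul_pow,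
    Real.norm_eq_abs, Real.norm_eq_abs, sq_abs, sq_abs, real_inner_comm]
  simp only [conj_trivial]
  nlinarith

theorem sum_grad_zero {N : ℕ} (f : Fin N → E → ℝ) (g : Fin N → E → E)
    (hg : ∀ i x, HasGradientAt (f i) (g i x) x) (xs : E)
    (hmin : ∀ z, (∑ i, f i xs) ≤ ∑ i, f i z) : ∑ i, g i xs = 0 := by
  have h : HasFDerivAt (fun z => ∑ i, f i z)
      (∑ i, (InnerProductSpace.toDual ℝ E) (g i xs)) xs :=
    HasFDerivAt.fun_sum (fun i _ => (hg i xs).hasFDerivAt)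
  have hm : IsLocalMin (fun z => ∑ i, f i z) xs := Filter.Eventually.of_forall hmin
  have := hm.hasFDerivAt_eq_zero h
  rw [← map_sum] at this
  exact (LinearIsometryEquiv.map_eq_zero_iff _).1 this

theorem norm_le_sqrt_mul {d : ℕ} (v : EuclideanSpace ℝ (Fin d)) (e : ℝ) (he : 0 ≤ e)
    (h : ∀ j, |v j| ≤ e) : ‖v‖ ≤ Real.sqrt d * e := by
  rw [EuclideanSpace.norm_eq]
  have : ∑ j, ‖v j‖ ^ 2 ≤ d * e ^ 2 := by
    calc ∑ j, ‖v j‖ ^ 2 ≤ ∑ _j : Fin d, e ^ 2 :=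
          Finset.sum_le_sum fun j _ => pow_le_pow_left₀ (norm_nonneg _) (h j) 2
      _ = d * e ^ 2 := by simp
  calc Real.sqrt (∑ j, ‖v j‖ ^ 2) ≤ Real.sqrt (d * e ^ 2) := Real.sqrt_le_sqrt this
    _ = Real.sqrt d * e := by rw [Real.sqrt_mul (by positivity), Real.sqrt_sq he]

end QuantHelpers

set_option maxHeartbeats 1000000 in
/-- Quantized decentralized gradient descent with
`b = ⌈log₂(24(κ+1)√d)⌉` bits per dimension: `α(b) < 1`, `1/(1 − α(b)) ≤ κ + 1`,
and for any `ε > 0` the iterates are `ε`-accurate after `(κ+1)·log(D/ε)`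
iterations (hence after at most `⌈log₂(24(κ+1)√d)⌉·d·(κ+1)·log(D/ε)`
communicated bits per node, `b·d` bits per iteration). -/
theorem quantized_decentralized_gradient {N d : ℕ} (hN : 1 ≤ N) (hd : 1 ≤ d)
    (μ L : ℝ) (hμ : 0 < μ) (hμL : μ ≤ L)
    (f : Fin N → EuclideanSpace ℝ (Fin d) → ℝ)
    (g : Fin N → EuclideanSpace ℝ (Fin d) → EuclideanSpace ℝ (Fin d))
    (hconv : ∀ i, ConvexOn ℝ Set.univ (fun x => f i x - μ / 2 * ‖x‖ ^ 2))
    (hgrad : ∀ i x, HasGradientAt (f i) (g i x) x)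
    (hlip : ∀ i x y, ‖g i x - g i y‖ ≤ L * ‖x - y‖)
    (xstar : EuclideanSpace ℝ (Fin d))
    (hmin : ∀ z, (∑ i, f i xstar) ≤ ∑ i, f i z)
    (γ κ : ℝ) (hγ : γ = 2 / (N * (μ + L))) (hκ : κ = L / μ) (hκ2 : 2 ≤ κ)
    (σ L_A L_C K α : ℝ)
    (hσ : σ = 1 - 2 / (κ + 1)) (hLA : L_A = γ * N * Real.sqrt d) (hLC : L_C = L)
    (hK : K = max 1 (2 * L_A * L_C / σ))
    (b : ℕ) (hb : b = ⌈Real.logb 2 (24 * (κ + 1) * Real.sqrt d)⌉₊)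
    (hα : α = K / (2 ^ b - 1) + σ)
    (D : ℝ) (hD : 0 < D)
    (r : ℕ → ℝ) (hr : ∀ k, r k = K / L_A * α ^ (k + 1) * D)
    (x : ℕ → EuclideanSpace ℝ (Fin d)) (c q : ℕ → Fin N → Fin d → ℝ)
    (hx0D : ‖x 0 - xstar‖ ≤ D)
    (hc : ∀ k, c k = fun i => (EuclideanSpace.equiv (Fin d) ℝ) (g i (x k)))
    (hq0 : q 0 = c 0)
    (hxk : ∀ k, x (k + 1) =
      x k - γ • (EuclideanSpace.equiv (Fin d) ℝ).symm (∑ i, q k i))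
    (hqk : ∀ k i, q (k + 1) i = quant (c (k + 1) i) (q k i) (r k) b) :
    α < 1 ∧ 1 / (1 - α) ≤ κ + 1 ∧
    (∀ ε : ℝ, 0 < ε → ∀ k : ℕ, (κ + 1) * Real.log (D / ε) ≤ (k : ℝ) →
      ‖x k - xstar‖ ≤ ε) := by
  have hκ1 : 0 < κ + 1 := by linarith
  have hκm : 0 < κ - 1 := by linarith
  have hL : L = κ * μ := by rw [hκ]; field_simp
  have hlt : μ < L := by rw [hL]; nlinarith
  have hL0 : 0 < L := by linarith
  have hN0 : (0:ℝ) < N := by exact_mod_cast hN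
  have hγN : γ * N = 2 / (μ + L) := by rw [hγ]; field_simp
  have hγ0 : 0 < γ := by rw [hγ]; positivity
  set s := Real.sqrt d with hs
  have hs1 : 1 ≤ s := by
    rw [hs]; apply Real.one_le_sqrt.2; exact_mod_cast hd
  have hLA0 : 0 < L_A := by rw [hLA]; positivity
  have hσ' : σ = (κ - 1) / (κ + 1) := by rw [hσ]; field_simp; ring
  have hσ0 : 0 < σ := by rw [hσ']; positivity
  have hLAL : L_A * L = 2 * κ * s / (κ + 1) := by
    rw [hLA, hγN, hL]
    have : μ + κ * μ = μ * (κ + 1) := by ring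
    rw [this]; field_simp
  have hval : 2 * L_A * L_C / σ = 4 * κ * s / (κ - 1) := by
    rw [hLC, mul_assoc, hLAL, hσ']; field_simp; ring
  have h4 : 4 ≤ 4 * κ * s / (κ - 1) := by
    rw [le_div_iff₀ hκm]; nlinarith
  have hKv : K = 4 * κ * s / (κ - 1) := by
    rw [hK, hval, max_eq_right (by linarith)]
  have hK4 : 4 ≤ K := by rw [hKv]; exact h4
  have hK8 : K ≤ 8 * s := by
    rw [hKv, div_le_iff₀ hκm]; nlinarith
  have hKσ : K * σ = 2 * (L_A * L) := by
    rw [hKv, hσ', hLAL]; field_simp; ring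
  have hpow : 24 * (κ + 1) * s ≤ (2:ℝ) ^ b := by
    have hpos : 0 < 24 * (κ + 1) * s := by positivity
    have h1 : Real.logb 2 (24 * (κ + 1) * s) ≤ b := by rw [hb]; exact Nat.le_ceil _
    rw [Real.logb_le_iff_le_rpow (by norm_num) hpos, Real.rpow_natCast] at h1
    exact h1
  set M : ℝ := 2 ^ b - 1 with hM
  have hM8 : 8 * s * (κ + 1) ≤ M := by nlinarith [mul_le_mul_of_nonneg_right hs1 hκ1.le]
  have hM0 : 0 < M := lt_of_lt_of_le (by positivity) hM8
  have hKM : K / M ≤ 1 / (κ + 1) := by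
    rw [div_le_div_iff₀ hM0 hκ1]; nlinarith
  have hKM0 : 0 < K / M := by positivity
  have hα0 : 0 < α := by rw [hα]; positivity
  have hαle : α ≤ 1 - 1 / (κ + 1) := by
    rw [hα, hσ]
    have : 2 / (κ + 1) = 1 / (κ + 1) + 1 / (κ + 1) := by ring
    linarith
  have hi0 : 0 < 1 / (κ + 1) := by positivity
  have hα1 : α < 1 := by linarith
  refine ⟨hα1, ?_, ?_⟩
  · rw [div_le_iff₀ (by linarith)]
    have : (κ + 1) * (1 / (κ + 1)) = 1 := by field_simp
    nlinarith
  -- error after quantization, relative to `α ^ k * D`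
  set η : ℝ := K / M / L_A with hη
  have hη0 : 0 < η := by positivity
  have hstrict : L * (α + 1) + η < K / L_A * α - K / L_A * α / M := by
    have hmul : L_A * L * (α + 1) + K / M < K * α - K * α / M := by
      have hLL : 0 < L_A * L := by positivity
      have e1 : K * α = K * (K / M) + K * σ := by rw [hα]; ring
      have e2 : K * α / M = (K / M) * α := by ring
      rw [e2, e1, hKσ]
      have m1 := mul_lt_mul_of_pos_left hα1 hLL
      have m2 := mul_lt_mul_of_pos_left hα1 hKM0
      have m3 := mul_le_mul_of_nonneg_right hK4 hKM0.le
      linarith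
    have e3 : L * (α + 1) + η = (L_A * L * (α + 1) + K / M) / L_A := by
      rw [hη]; field_simp
    have e4 : K / L_A * α - K / L_A * α / M = (K * α - K * α / M) / L_A := by
      field_simp
    rw [e3, e4]
    exact div_lt_div_of_pos_right hmul hLA0
  have hsum0 := sum_grad_zero f g hgrad xstar hmin
  -- one exact gradient step contracts
  have hcontr : ∀ z, ‖(z - xstar) - γ • ∑ i, g i z‖ ≤ σ * ‖z - xstar‖ := by
    intro z
    have hc1 : ∀ i, ‖(μ + L) • (z - xstar) - (2:ℝ) • (g i z - g i xstar)‖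
        ≤ (L - μ) * ‖z - xstar‖ := fun i =>
      contraction (f i) (g i) μ L hlt (hgrad i) (hconv i) (hlip i) z xstar
    have e : (z - xstar) - γ • ∑ i, g i z
        = (1 / (N * (μ + L))) • ∑ i, ((μ + L) • (z - xstar) - (2:ℝ) • (g i z - g i xstar)) := by
      have e0 : ∑ i, (2:ℝ) • (g i z - g i xstar) = (2:ℝ) • ∑ i, g i z := by
        rw [← Finset.smul_sum, Finset.sum_sub_distrib, hsum0, sub_zero]
      rw [Finset.sum_sub_distrib, e0,
        Finset.sum_const, Finset.card_univ, Fintype.card_fin, smul_sub,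
        ← Nat.cast_smul_eq_nsmul ℝ, hγ]
      have e1 : 1 / (N * (μ + L)) * ((N:ℝ) * (μ + L)) = 1 := by field_simp
      have e2 : 1 / (N * (μ + L)) * (2:ℝ) = 2 / (N * (μ + L)) := by ring
      rw [smul_smul (N:ℝ), smul_smul, smul_smul, e1, e2, one_smul]
    have hb1 : ‖∑ i, ((μ + L) • (z - xstar) - (2:ℝ) • (g i z - g i xstar))‖
        ≤ N * ((L - μ) * ‖z - xstar‖) := by
      refine (norm_sum_le _ _).trans ((Finset.sum_le_sum fun i _ => hc1 i).trans ?_)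
      simp
    rw [e, norm_smul, Real.norm_of_nonneg (by positivity)]
    refine (mul_le_mul_of_nonneg_left hb1 (by positivity)).trans (le_of_eq ?_)
    rw [hσ', hL]
    have : μ + κ * μ = μ * (κ + 1) := by ring
    rw [this]; field_simp
  have main : ∀ k, ‖x k - xstar‖ ≤ α ^ k * D ∧ ∀ i j, |q k i j - c k i j| ≤ η * (α ^ k * D) := by
    intro k
    induction k with
    | zero =>
      refine ⟨by simpa using hx0D, fun i j => ?_⟩
      rw [hq0]; simp; positivity
    | succ k ih =>
      obtain ⟨ihx, ihq⟩ := ih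
      have hP : 0 < α ^ k * D := by positivity
      set P := α ^ k * D with hPd
      have hPs : α ^ (k + 1) * D = α * P := by rw [hPd, pow_succ]; ring
      rw [hPs]
      have hx1 : ‖x (k + 1) - xstar‖ ≤ α * P := by
        set v : Fin N → EuclideanSpace ℝ (Fin d) := fun i =>
          (EuclideanSpace.equiv (Fin d) ℝ).symm (q k i) - g i (x k) with hv
        have hvn : ∀ i, ‖v i‖ ≤ s * (η * P) := by
          intro i
          apply norm_le_sqrt_mul _ _ (by positivity)
          intro j
          have := ihq i j
          rw [hc k] at this
          simpa [hv] using this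
        have e : x (k + 1) - xstar
            = ((x k - xstar) - γ • ∑ i, g i (x k)) - γ • ∑ i, v i := by
          rw [hxk k, map_sum, hv, Finset.sum_sub_distrib, smul_sub]; abel
        have hvs : ‖∑ i, v i‖ ≤ N * (s * (η * P)) := by
          refine (norm_sum_le _ _).trans ((Finset.sum_le_sum fun i _ => hvn i).trans ?_)
          simp
        rw [e]
        refine (norm_sub_le _ _).trans ?_
        rw [norm_smul γ (∑ i, v i), Real.norm_of_nonneg hγ0.le]
        have h1 := hcontr (x k)
        have h2 := mul_le_mul_of_nonneg_left hvs hγ0.le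
        have h3 := mul_le_mul_of_nonneg_left ihx hσ0.le
        have h5 : γ * (N * (s * (η * P))) = K / M * P := by
          have : γ * (N * (s * (η * P))) = L_A * η * P := by rw [hLA]; ring
          rw [this, hη]; field_simp
        have h6 : α * P = K / M * P + σ * P := by rw [hα]; ring
        linarith
      refine ⟨hx1, fun i j => ?_⟩
      have hrk : r k = K / L_A * α * P := by rw [hr, hPd, pow_succ]; ring
      have hδ : r k / (2 ^ b - 1) = η * (α * P) := by
        rw [← hM, hrk, hη]; field_simp
      rw [hqk k i, ← hδ]
      apply quant_error
      · rw [hδ]; positivity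
      · have h1 := hlip i (x (k + 1)) (x k)
        have h2 : ‖x (k + 1) - x k‖ ≤ α * P + P := by
          have : x (k + 1) - x k = (x (k + 1) - xstar) - (x k - xstar) := by abel
          rw [this]
          exact (norm_sub_le _ _).trans (add_le_add hx1 ihx)
        have h3 : |c (k + 1) i j - c k i j| ≤ ‖g i (x (k + 1)) - g i (x k)‖ := by
          have := PiLp.norm_apply_le (g i (x (k + 1)) - g i (x k)) j
          rw [hc (k + 1), hc k]
          simpa using this
        have h4 := ihq i j
        rw [abs_sub_comm] at h4
        have h5 := abs_sub_le (c (k + 1) i j) (c k i j) (q k i j)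
        have h6 := mul_le_mul_of_nonneg_left h2 hL0.le
        have h7 := mul_lt_mul_of_pos_right hstrict hP
        have h8 : r k - r k / (2 ^ b - 1) = (K / L_A * α - K / L_A * α / M) * P := by
          rw [← hM, hrk]; ring
        rw [h8]
        linarith
  intro ε hε k hk
  refine (main k).1.trans ?_
  have hexp : α ≤ Real.exp (-(1 / (κ + 1))) := by
    have := Real.add_one_le_exp (-(1 / (κ + 1)))
    linarith
  have h1 : α ^ k ≤ Real.exp (-Real.log (D / ε)) := by
    refine (pow_le_pow_left₀ hα0.le hexp k).trans ?_
    rw [← Real.exp_nat_mul, Real.exp_le_exp]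
    have : Real.log (D / ε) ≤ k / (κ + 1) := by
      rw [le_div_iff₀ hκ1]; linarith
    have e : (k:ℝ) * -(1 / (κ + 1)) = -(k / (κ + 1)) := by ring
    rw [e]; linarith
  rw [Real.exp_neg, Real.exp_log (by positivity)] at h1
  refine (mul_le_mul_of_nonneg_right h1 hD.le).trans (le_of_eq ?_)
  field_simp
end

section
/- Let f_1,…,f_N : ℝ^d → ℝ each be μ-strongly convex and differentiable with L-Lipschitz gradient, with κ = L/μ ≥ 2, and let x* ∈ [0,1]^d be the minimizer of F(z) = Σ_{i=1}^N f_i(z) over [0,1]^d. Consider the quantized iteration with E = ℝ^d and the Euclidean norm, projected-gradient update A(c,x) = Proj_{[0,1]^d}(x − γ Σ_{i=1}^N c_i), C_i(x) = ∇f_i(x), γ = 1/(NL), σ = √(1 − 1/κ), L_A = √d/L, L_C = L, D = √d, constants K, α(b), r^k as in the setup, and b = ⌈log₂(16κ√(2d))⌉. Then α(b) < 1 with 1/(1 − α(b)) ≤ 4κ; consequently, for any ε > 0 and every integer k ≥ 4κ log(√d/ε), the iterate satisfies ‖x^k − x*‖₂ ≤ ε, so an ε-accurate solution is reached after each node has communicated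 at most 4⌈log₂(16κ√(2d))⌉ · κ · d · log(√d/ε) bits. -/
/-- The Euclidean projection onto the box `[0,1]^d`, i.e. the componentwise
clamp of each coordinate to `[0,1]`. -/
noncomputable def projBox (d : ℕ) (x : EuclideanSpace ℝ (Fin d)) :
    EuclideanSpace ℝ (Fin d) :=
  (EuclideanSpace.equiv (Fin d) ℝ).symm
    (fun j => min 1 (max 0 ((EuclideanSpace.equiv (Fin d) ℝ) x j)))

theorem qpg_descent {E : Type*} [NormedAddCommGroup E] [InnerProductSpace ℝ E] [CompleteSpace E]
    (f : E → ℝ) (g : E → E) (L : ℝ)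
    (hgrad : ∀ x, HasGradientAt f (g x) x)
    (hlip : ∀ x y, ‖g x - g y‖ ≤ L * ‖x - y‖) (x y : E) :
    f y ≤ f x + inner ℝ (g x) (y - x) + L / 2 * ‖y - x‖ ^ 2 := by
  set v := y - x with hv
  have hline : ∀ t : ℝ, HasDerivAt (fun t : ℝ => f (x + t • v)) (inner ℝ (g (x + t • v)) v) t := by
    intro t
    have h1 : HasDerivAt (fun t : ℝ => x + t • v) v t := by
      simpa using ((hasDerivAt_id t).smul_const v).const_add x
    have h2 := (hgrad (x + t • v)).hasFDerivAt.comp_hasDerivAt t h1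
    refine (show HasDerivAt (fun t : ℝ => f (x + t • v)) _ t from h2).congr_deriv ?_
    simp
  have hd : ∀ t : ℝ, HasDerivAt
      (fun t : ℝ => f (x + t • v) - t * inner ℝ (g x) v - L / 2 * ‖v‖ ^ 2 * t ^ 2)
      (inner ℝ (g (x + t • v)) v - inner ℝ (g x) v - L * ‖v‖ ^ 2 * t) t := by
    intro t
    have h3 := ((hline t).sub ((hasDerivAt_id t).mul_const (inner ℝ (g x) v))).sub
      ((hasDerivAt_pow 2 t).const_mul (L / 2 * ‖v‖ ^ 2))
    refine h3.congr_deriv ?_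
    push_cast
    ring
  have hanti : AntitoneOn
      (fun t : ℝ => f (x + t • v) - t * inner ℝ (g x) v - L / 2 * ‖v‖ ^ 2 * t ^ 2)
      (Set.Icc 0 1) := by
    apply antitoneOn_of_deriv_nonpos (convex_Icc 0 1)
    · exact fun t _ => (hd t).continuousAt.continuousWithinAt
    · exact fun t _ => (hd t).differentiableAt.differentiableWithinAt
    · intro t ht
      rw [interior_Icc] at ht
      rw [(hd t).deriv]
      have h4 : inner ℝ (g (x + t • v) - g x) v ≤ L * t * ‖v‖ * ‖v‖ := by
        refine (real_inner_le_norm _ _).trans ?_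
        gcongr
        refine (hlip _ _).trans (le_of_eq ?_)
        rw [add_sub_cancel_left, norm_smul, Real.norm_of_nonneg ht.1.le]
        ring
      rw [inner_sub_left] at h4
      nlinarith
  have h5 := hanti (Set.left_mem_Icc.2 zero_le_one) (Set.right_mem_Icc.2 zero_le_one) zero_le_one
  simp only [one_smul, zero_smul, add_zero] at h5
  have h6 : x + v = y := by rw [hv]; abel
  rw [h6] at h5
  linarith

theorem qpg_strong {E : Type*} [NormedAddCommGroup E] [InnerProductSpace ℝ E] [CompleteSpace E]
    (f : E → ℝ) (g : E → E) (μ : ℝ)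
    (hconv : ConvexOn ℝ Set.univ (fun x => f x - μ / 2 * ‖x‖ ^ 2))
    (hgrad : ∀ x, HasGradientAt f (g x) x) (x y : E) :
    f x + inner ℝ (g x) (y - x) + μ / 2 * ‖y - x‖ ^ 2 ≤ f y := by
  set v := y - x with hv
  have h6 : x + v = y := by rw [hv]; abel
  have hexp : ∀ t : ℝ, ‖x + t • v‖ ^ 2 = ‖x‖ ^ 2 + 2 * t * inner ℝ x v + t ^ 2 * ‖v‖ ^ 2 := by
    intro t
    rw [norm_add_sq_real, inner_smul_right, norm_smul, mul_pow, Real.norm_eq_abs, sq_abs]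
    ring
  have hd : HasDerivAt (fun t : ℝ => f (x + t • v) - μ / 2 * ‖x + t • v‖ ^ 2)
      (inner ℝ (g x) v - μ * inner ℝ x v) 0 := by
    have h1 : HasDerivAt (fun t : ℝ => x + t • v) v 0 := by
      simpa using ((hasDerivAt_id (0:ℝ)).smul_const v).const_add x
    have h0 : x + (0:ℝ) • v = x := by simp
    have h2 := (hgrad (x + (0:ℝ) • v)).hasFDerivAt.comp_hasDerivAt (0:ℝ) h1
    rw [h0] at h2
    have h2' : HasDerivAt (fun t : ℝ => f (x + t • v)) (inner ℝ (g x) v) 0 := by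
      refine (show HasDerivAt (fun t : ℝ => f (x + t • v)) _ 0 from h2).congr_deriv ?_
      simp
    simp only [hexp]
    have h3 : HasDerivAt (fun t : ℝ => ‖x‖ ^ 2 + 2 * t * inner ℝ x v + t ^ 2 * ‖v‖ ^ 2)
        (2 * inner ℝ x v) 0 := by
      have h7 := ((((hasDerivAt_id (0:ℝ)).const_mul 2).mul_const (inner ℝ x v)).const_add
        (‖x‖ ^ 2)).add ((hasDerivAt_pow 2 (0:ℝ)).mul_const (‖v‖ ^ 2))
      refine h7.congr_deriv ?_
      simp
    refine (h2'.sub (h3.const_mul (μ / 2))).congr_deriv ?_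
    ring
  have hc : ConvexOn ℝ Set.univ (fun t : ℝ => f (x + t • v) - μ / 2 * ‖x + t • v‖ ^ 2) := by
    refine ⟨convex_univ, fun s _ t _ a b ha hb hab => ?_⟩
    have h8 := hconv.2 (Set.mem_univ (x + s • v)) (Set.mem_univ (x + t • v)) ha hb hab
    have h9 : a • (x + s • v) + b • (x + t • v) = x + (a • s + b • t) • v := by
      rw [smul_add, smul_add, add_smul, smul_assoc, smul_assoc]
      nth_rewrite 3 [← one_smul ℝ x]
      rw [← hab, add_smul]
      abel
    rw [h9] at h8
    exact h8
  have h10 := hc.le_slope_of_hasDerivAt (Set.mem_univ 0) (Set.mem_univ 1) zero_lt_one hd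
  rw [slope_def_field] at h10
  have e1 := hexp 1
  simp only [one_smul] at e1
  simp only [one_smul, zero_smul, add_zero, h6, sub_zero, div_one] at h10
  rw [h6] at e1
  rw [e1] at h10
  nlinarith

theorem qpg_quant {d : ℕ} (c q : Fin d → ℝ) (r : ℝ) (b : ℕ) (j : Fin d)
    (hδ : 0 < r / (2 ^ b - 1)) (h : |c j - q j| < r - r / (2 ^ b - 1)) :
    |quant c q r b j - c j| ≤ r / (2 ^ b - 1) := by
  unfold quant
  set δ := r / (2 ^ b - 1) with hδ'
  have h' := abs_lt.1 h
  simp only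
  rw [if_neg (by linarith), if_neg (by linarith)]
  set u := (c j - q j + r + δ) / (2 * δ) with hu
  have hu2 : 2 * δ * u = c j - q j + r + δ := by rw [hu]; field_simp
  have h1 := Int.floor_le u
  have h2 := (Int.lt_floor_add_one u).le
  rw [abs_le]
  constructor <;> nlinarith

theorem qpg_proj_apply {d : ℕ} (x : EuclideanSpace ℝ (Fin d)) (j : Fin d) :
    projBox d x j = min 1 (max 0 (x j)) := rfl

theorem qpg_proj_lip {d : ℕ} (x y : EuclideanSpace ℝ (Fin d)) :
    ‖projBox d x - projBox d y‖ ≤ ‖x - y‖ := by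
  rw [EuclideanSpace.norm_eq, EuclideanSpace.norm_eq]
  apply Real.sqrt_le_sqrt
  apply Finset.sum_le_sum
  intro j _
  simp only [PiLp.sub_apply, qpg_proj_apply]
  apply pow_le_pow_left₀ (norm_nonneg _)
  rw [Real.norm_eq_abs, Real.norm_eq_abs]
  refine (abs_min_sub_min_le_max _ _ _ _).trans ?_
  simp only [sub_self, abs_zero]
  refine max_le (abs_nonneg _) ((abs_max_sub_max_le_max _ _ _ _).trans ?_)
  simp

theorem qpg_proj_inner {d : ℕ} (z y : EuclideanSpace ℝ (Fin d))
    (hy : ∀ j, y j ∈ Set.Icc (0 : ℝ) 1) :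
    inner ℝ (z - projBox d z) (y - projBox d z) ≤ 0 := by
  rw [PiLp.inner_apply]
  apply Finset.sum_nonpos
  intro j _
  simp only [PiLp.sub_apply, qpg_proj_apply, RCLike.inner_apply, conj_trivial]
  obtain ⟨h0, h1⟩ := hy j
  rcases le_total (z j) 0 with h | h
  · rw [max_eq_left h, min_eq_right zero_le_one]; nlinarith
  · rw [max_eq_right h]
    rcases le_total (z j) 1 with h' | h'
    · rw [min_eq_right h']; simp
    · rw [min_eq_left h']; nlinarith

theorem qpg_norm_le {d : ℕ} (v : EuclideanSpace ℝ (Fin d)) (M : ℝ) (hM : 0 ≤ M)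
    (h : ∀ j, |v j| ≤ M) : ‖v‖ ≤ Real.sqrt d * M := by
  rw [EuclideanSpace.norm_eq]
  have h1 : ∑ j, ‖v j‖ ^ 2 ≤ d * M ^ 2 := by
    calc ∑ j, ‖v j‖ ^ 2 ≤ ∑ j : Fin d, M ^ 2 :=
          Finset.sum_le_sum fun j _ => pow_le_pow_left₀ (norm_nonneg _) (h j) 2
      _ = d * M ^ 2 := by simp
  calc Real.sqrt (∑ j, ‖v j‖ ^ 2) ≤ Real.sqrt (d * M ^ 2) := Real.sqrt_le_sqrt h1
    _ = Real.sqrt d * M := by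
      rw [Real.sqrt_mul (Nat.cast_nonneg d), Real.sqrt_sq hM]

/-- one exact projected gradient step is a contraction towards the minimizer -/
theorem qpg_contract {d : ℕ} (F : EuclideanSpace ℝ (Fin d) → ℝ)
    (x G xstar : EuclideanSpace ℝ (Fin d)) (M m : ℝ) (hM : 0 < M)
    (hup : ∀ y, F y ≤ F x + inner ℝ G (y - x) + M / 2 * ‖y - x‖ ^ 2)
    (hlo : ∀ y, F x + inner ℝ G (y - x) + m / 2 * ‖y - x‖ ^ 2 ≤ F y)
    (hxs : ∀ j, xstar j ∈ Set.Icc (0 : ℝ) 1)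
    (hmin : ∀ z : EuclideanSpace ℝ (Fin d), (∀ j, z j ∈ Set.Icc (0 : ℝ) 1) → F xstar ≤ F z) :
    ‖projBox d (x - (1 / M) • G) - xstar‖ ^ 2 ≤ (1 - m / M) * ‖x - xstar‖ ^ 2 := by
  have hp := qpg_proj_inner (x - (1 / M) • G) xstar hxs
  have hbox : ∀ j, projBox d (x - (1 / M) • G) j ∈ Set.Icc (0 : ℝ) 1 := by
    intro j
    rw [qpg_proj_apply]
    exact ⟨le_min zero_le_one (le_max_left _ _), min_le_left _ _⟩
  set p := projBox d (x - (1 / M) • G) with hpdef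
  have h1 := hup p
  have h2 := hlo xstar
  have h3 := hmin p hbox
  have e1 : x - (1 / M) • G - p = (x - p) - (1 / M) • G := by abel
  rw [e1, inner_sub_left, inner_smul_left] at hp
  simp only [conj_trivial] at hp
  have e2 : inner ℝ G (xstar - p) = inner ℝ G (xstar - x) - inner ℝ G (p - x) := by
    rw [← inner_sub_right]; congr 1; abel
  have e3 : ‖x - xstar‖ ^ 2 = ‖x - p‖ ^ 2 - 2 * inner ℝ (x - p) (xstar - p) + ‖p - xstar‖ ^ 2 := by
    rw [norm_sub_rev p xstar, ← norm_sub_sq_real]; congr 2; abel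
  have e4 : ‖xstar - x‖ = ‖x - xstar‖ := norm_sub_rev _ _
  have e5 : ‖p - x‖ = ‖x - p‖ := norm_sub_rev _ _
  rw [e4] at h2
  rw [e5] at h1
  have h4 : M * inner ℝ (x - p) (xstar - p) ≤ inner ℝ G (xstar - p) := by
    have := mul_le_mul_of_nonneg_left hp hM.le
    have e6 : M * (1 / M * inner ℝ G (xstar - p)) = inner ℝ G (xstar - p) := by field_simp
    linarith
  have h5 : M * ‖p - xstar‖ ^ 2 ≤ M * ((1 - m / M) * ‖x - xstar‖ ^ 2) := by
    have e7 : M * ((1 - m / M) * ‖x - xstar‖ ^ 2) = (M - m) * ‖x - xstar‖ ^ 2 := by field_simp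
    rw [e7]
    nlinarith
  exact le_of_mul_le_mul_left h5 hM

theorem qpg_const (κ s σ K α : ℝ) (hκ2 : 2 ≤ κ) (hs : 1 ≤ s)
    (hσ : σ = Real.sqrt (1 - 1 / κ)) (hK : K = max 1 (2 * s / σ)) (B : ℝ)
    (hB : 16 * κ * (Real.sqrt 2 * s) ≤ B) (hα : α = K / (B - 1) + σ) :
    0 < σ ∧ 2 < K ∧ 2 * s ≤ K * σ ∧ 1 < B ∧ α ≤ 1 - 1 / (4 * κ) := by
  have hκ0 : 0 < κ := by linarith
  have hinv : 1 / κ ≤ 1 / 2 := one_div_le_one_div_of_le (by norm_num) hκ2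
  have hinv0 : 0 < 1 / κ := by positivity
  have hσ0 : 0 < σ := by rw [hσ]; exact Real.sqrt_pos.2 (by linarith)
  have hσsq : σ ^ 2 = 1 - 1 / κ := by rw [hσ]; exact Real.sq_sqrt (by linarith)
  have hσ1 : σ < 1 := by nlinarith
  have ht : 1 < Real.sqrt 2 := by rw [Real.lt_sqrt] <;> norm_num
  have ht2 : Real.sqrt 2 ^ 2 = 2 := Real.sq_sqrt (by norm_num)
  set t := Real.sqrt 2
  have hts : 1 ≤ t * s := by nlinarith
  have hBig : 32 ≤ B := by nlinarith
  have h2 : 2 < 2 * s / σ := by rw [lt_div_iff₀ hσ0]; nlinarith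
  have hKeq : K = 2 * s / σ := by rw [hK]; exact max_eq_right (by linarith)
  have hKs : K * σ = 2 * s := by rw [hKeq]; field_simp
  have htσ : 1 ≤ t * σ := by
    by_contra hcon
    push Not at hcon
    have : 0 < t * σ := by positivity
    nlinarith [mul_pow t σ 2]
  have hKle : K ≤ 2 * (t * s) := by
    rw [hKeq, div_le_iff₀ hσ0]; nlinarith
  refine ⟨hσ0, by rw [hKeq]; exact h2, hKs.ge, by linarith, ?_⟩
  have hσle : σ ≤ 1 - 1 / κ / 2 := by nlinarith
  have hfrac : K / (B - 1) ≤ 1 / (4 * κ) := by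
    rw [div_le_div_iff₀ (by linarith) (by positivity)]
    nlinarith
  have e : 1 / (4 * κ) = 1 / κ / 4 := by field_simp
  rw [e] at hfrac
  rw [hα, e]
  linarith

set_option maxHeartbeats 1000000 in
/-- Quantized projected gradient descent over the box `[0,1]^d`
with `b = ⌈log₂(16κ√(2d))⌉` bits per dimension: `α(b) < 1`,
`1/(1 − α(b)) ≤ 4κ`, and for any `ε > 0` the iterates are `ε`-accurate after
`4κ·log(√d/ε)` iterations (hence after at most `4⌈log₂(16κ√(2d))⌉·κ·d·log(√d/ε)`
communicated bits per node, `b·d` bits per iteration). -/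
theorem quantized_projected_gradient {N d : ℕ} (hN : 1 ≤ N) (hd : 1 ≤ d)
    (μ L : ℝ) (hμ : 0 < μ) (hμL : μ ≤ L)
    (f : Fin N → EuclideanSpace ℝ (Fin d) → ℝ)
    (g : Fin N → EuclideanSpace ℝ (Fin d) → EuclideanSpace ℝ (Fin d))
    (hconv : ∀ i, ConvexOn ℝ Set.univ (fun x => f i x - μ / 2 * ‖x‖ ^ 2))
    (hgrad : ∀ i x, HasGradientAt (f i) (g i x) x)
    (hlip : ∀ i x y, ‖g i x - g i y‖ ≤ L * ‖x - y‖)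
    (xstar : EuclideanSpace ℝ (Fin d))
    (hxstar : ∀ j, (EuclideanSpace.equiv (Fin d) ℝ) xstar j ∈ Set.Icc (0 : ℝ) 1)
    (hmin : ∀ z : EuclideanSpace ℝ (Fin d),
      (∀ j, (EuclideanSpace.equiv (Fin d) ℝ) z j ∈ Set.Icc (0 : ℝ) 1) →
      (∑ i, f i xstar) ≤ ∑ i, f i z)
    (γ κ : ℝ) (hγ : γ = 1 / (N * L)) (hκ : κ = L / μ) (hκ2 : 2 ≤ κ)
    (σ L_A L_C K α D : ℝ)
    (hσ : σ = Real.sqrt (1 - 1 / κ)) (hLA : L_A = Real.sqrt d / L) (hLC : L_C = L)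
    (hD : D = Real.sqrt d)
    (hK : K = max 1 (2 * L_A * L_C / σ))
    (b : ℕ) (hb : b = ⌈Real.logb 2 (16 * κ * Real.sqrt (2 * d))⌉₊)
    (hα : α = K / (2 ^ b - 1) + σ)
    (r : ℕ → ℝ) (hr : ∀ k, r k = K / L_A * α ^ (k + 1) * D)
    (x : ℕ → EuclideanSpace ℝ (Fin d)) (c q : ℕ → Fin N → Fin d → ℝ)
    (hx0 : ∀ j, (EuclideanSpace.equiv (Fin d) ℝ) (x 0) j ∈ Set.Icc (0 : ℝ) 1)
    (hc : ∀ k, c k = fun i => (EuclideanSpace.equiv (Fin d) ℝ) (g i (x k)))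
    (hq0 : q 0 = c 0)
    (hxk : ∀ k, x (k + 1) =
      projBox d (x k - γ • (EuclideanSpace.equiv (Fin d) ℝ).symm (∑ i, q k i)))
    (hqk : ∀ k i, q (k + 1) i = quant (c (k + 1) i) (q k i) (r k) b) :
    α < 1 ∧ 1 / (1 - α) ≤ 4 * κ ∧
    (∀ ε : ℝ, 0 < ε → ∀ k : ℕ, 4 * κ * Real.log (Real.sqrt d / ε) ≤ (k : ℝ) →
      ‖x k - xstar‖ ≤ ε) := by
  have hL : 0 < L := lt_of_lt_of_le hμ hμL
  have hNpos : (0 : ℝ) < N := by exact_mod_cast hN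
  have hd1 : (1 : ℝ) ≤ d := by exact_mod_cast hd
  set s := Real.sqrt d with hsdef
  have hs : 1 ≤ s := by rw [hsdef, Real.one_le_sqrt]; exact hd1
  have hs0 : 0 < s := by linarith
  have hκ0 : 0 < κ := by linarith
  have hK' : K = max 1 (2 * s / σ) := by
    rw [hK, hLA, hLC]; congr 2; field_simp
  have hB : 16 * κ * (Real.sqrt 2 * s) ≤ (2 : ℝ) ^ b := by
    have h2d : Real.sqrt (2 * d) = Real.sqrt 2 * s := Real.sqrt_mul (by norm_num) _
    rw [h2d] at hb
    have hpos : 0 < 16 * κ * (Real.sqrt 2 * s) := by positivity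
    have h1 : Real.logb 2 (16 * κ * (Real.sqrt 2 * s)) ≤ b := by rw [hb]; exact Nat.le_ceil _
    rw [Real.logb_le_iff_le_rpow (by norm_num) hpos, Real.rpow_natCast] at h1
    exact h1
  obtain ⟨hσ0, hK2, hKσ, hB1, hα1⟩ := qpg_const κ s σ K α hκ2 hs hσ hK' _ hB hα
  set B : ℝ := (2 : ℝ) ^ b with hBdef
  have hB10 : 0 < B - 1 := by linarith
  have hinv0 : 0 < 1 / (4 * κ) := by positivity
  have hw0 : 0 < K / (B - 1) := by apply div_pos <;> linarith
  have hα0 : 0 < α := by rw [hα]; linarith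
  have hαlt : α < 1 := by linarith
  have hr' : ∀ k, r k = K * L * α ^ (k + 1) := by
    intro k; rw [hr, hLA, hD]; field_simp
  have hFup : ∀ x y, ∑ i, f i y ≤ ∑ i, f i x + inner ℝ (∑ i, g i x) (y - x)
      + (N * L) / 2 * ‖y - x‖ ^ 2 := by
    intro x y
    rw [sum_inner]
    have h1 := Finset.sum_le_sum (s := Finset.univ) fun i _ =>
      qpg_descent (f i) (g i) L (hgrad i) (hlip i) x y
    simp only [Finset.sum_add_distrib, Finset.sum_const, Finset.card_univ, Fintype.card_fin,
      nsmul_eq_mul] at h1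
    linarith
  have hFlo : ∀ x y, ∑ i, f i x + inner ℝ (∑ i, g i x) (y - x)
      + (N * μ) / 2 * ‖y - x‖ ^ 2 ≤ ∑ i, f i y := by
    intro x y
    rw [sum_inner]
    have h1 := Finset.sum_le_sum (s := Finset.univ) fun i _ =>
      qpg_strong (f i) (g i) μ (hconv i) (hgrad i) x y
    simp only [Finset.sum_add_distrib, Finset.sum_const, Finset.card_univ, Fintype.card_fin,
      nsmul_eq_mul] at h1
    linarith
  have hcontr : ∀ y, ‖projBox d (y - γ • ∑ i, g i y) - xstar‖ ≤ σ * ‖y - xstar‖ := by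
    intro y
    have h1 := qpg_contract (fun z => ∑ i, f i z) y (∑ i, g i y) xstar (N * L) (N * μ)
      (by positivity) (hFup y) (hFlo y) hxstar hmin
    rw [← hγ] at h1
    have hσsq : σ ^ 2 = 1 - N * μ / (N * L) := by
      have hle : 1 / κ ≤ 1 / 2 := one_div_le_one_div_of_le (by norm_num) hκ2
      rw [hσ, Real.sq_sqrt (by linarith), hκ]
      field_simp
    rw [← hσsq, ← mul_pow] at h1
    exact le_of_sq_le_sq h1 (by positivity)
  -- one perturbed step
  have hstep : ∀ k (e : ℝ), 0 ≤ e → (∀ i j, |q k i j - c k i j| ≤ e) →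
      ‖x (k + 1) - xstar‖ ≤ σ * ‖x k - xstar‖ + s / L * e := by
    intro k e he hqc
    set Q : EuclideanSpace ℝ (Fin d) := (EuclideanSpace.equiv (Fin d) ℝ).symm (∑ i, q k i) with hQ
    have h1 : ‖x (k + 1) - projBox d (x k - γ • ∑ i, g i (x k))‖ ≤ s / L * e := by
      rw [hxk k]
      refine (qpg_proj_lip _ _).trans ?_
      have e1 : x k - γ • Q - (x k - γ • ∑ i, g i (x k)) = γ • (∑ i, g i (x k) - Q) := by
        rw [smul_sub]; abel
      rw [e1, norm_smul]
      have hγ0 : 0 < γ := by rw [hγ]; positivity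
      have h2 : ‖∑ i, g i (x k) - Q‖ ≤ s * (N * e) := by
        apply qpg_norm_le _ _ (by positivity)
        intro j
        have e2 : (∑ i, g i (x k) - Q) j = ∑ i, (c k i j - q k i j) := by
          have e3 : Q j = ∑ i, q k i j := by
            have : Q j = (∑ i, q k i) j := rfl
            rw [this, Finset.sum_apply]
          have e4 : (∑ i, g i (x k)) j = ∑ i, c k i j := by
            rw [hc k]
            simp
          rw [PiLp.sub_apply, e3, e4, Finset.sum_sub_distrib]
        rw [e2]
        refine (Finset.abs_sum_le_sum_abs _ _).trans ?_
        calc ∑ i, |c k i j - q k i j| ≤ ∑ _i : Fin N, e :=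
              Finset.sum_le_sum fun i _ => by rw [abs_sub_comm]; exact hqc i j
          _ = N * e := by simp
      rw [Real.norm_of_nonneg hγ0.le]
      calc γ * ‖∑ i, g i (x k) - Q‖ ≤ γ * (s * (N * e)) := by gcongr
        _ = s / L * e := by rw [hγ]; field_simp
    calc ‖x (k + 1) - xstar‖ ≤ ‖x (k + 1) - projBox d (x k - γ • ∑ i, g i (x k))‖
          + ‖projBox d (x k - γ • ∑ i, g i (x k)) - xstar‖ := norm_sub_le_norm_sub_add_norm_sub _ _ _
      _ ≤ s / L * e + σ * ‖x k - xstar‖ := add_le_add h1 (hcontr _)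
      _ = _ := by ring
  have hmain : ∀ k, ‖x k - xstar‖ ≤ α ^ k * s ∧
      ∀ i j, |q k i j - c k i j| ≤ K * L * α ^ k / (B - 1) := by
    intro k
    induction k with
    | zero =>
      constructor
      · have := qpg_norm_le (x 0 - xstar) 1 zero_le_one (by
          intro j
          have h1 := hx0 j
          have h2 := hxstar j
          have e : (x 0 - xstar) j = EuclideanSpace.equiv (Fin d) ℝ (x 0) j
            - EuclideanSpace.equiv (Fin d) ℝ xstar j := rfl
          rw [e, abs_le]
          constructor <;> linarith [h1.1, h1.2, h2.1, h2.2])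
        rw [pow_zero, one_mul]
        linarith
      · intro i j
        rw [hq0, sub_self, abs_zero]
        have : 0 < K := by linarith
        positivity
    | succ k ih =>
      obtain ⟨ihx, ihq⟩ := ih
      have hK0 : 0 < K := by linarith
      have hP : 0 < α ^ k := by positivity
      have hx1 : ‖x (k + 1) - xstar‖ ≤ α ^ (k + 1) * s := by
        refine (hstep k _ (by positivity) ihq).trans ?_
        have e : s / L * (K * L * α ^ k / (B - 1)) = α ^ k * s * (K / (B - 1)) := by field_simp
        rw [e, pow_succ]
        have h1 : α ^ k * α * s = α ^ k * s * (K / (B - 1)) + σ * (α ^ k * s) := by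
          rw [hα]; ring
        rw [h1]
        have := mul_le_mul_of_nonneg_left ihx hσ0.le
        linarith
      refine ⟨hx1, fun i j => ?_⟩
      have hrd : r k / (B - 1) = K * L * α ^ (k + 1) / (B - 1) := by rw [hr']
      rw [hqk k i, ← hrd]
      refine qpg_quant _ _ _ _ _ (by rw [← hBdef, hrd]; positivity) ?_
      rw [← hBdef, hrd, hr']
      have hcc : |c (k + 1) i j - c k i j| ≤ L * (α ^ (k + 1) * s + α ^ k * s) := by
        have e : c (k + 1) i j - c k i j = (g i (x (k + 1)) - g i (x k)) j := by
          rw [hc, hc]; rfl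
        rw [e]
        refine (PiLp.norm_apply_le (g i (x (k + 1)) - g i (x k)) j).trans ?_
        refine (hlip _ _ _).trans ?_
        gcongr
        refine (norm_sub_le_norm_sub_add_norm_sub _ xstar _).trans ?_
        rw [norm_sub_rev xstar (x k)]
        exact add_le_add hx1 ihx
      have htri : |c (k + 1) i j - q k i j| ≤ |c (k + 1) i j - c k i j| + |q k i j - c k i j| := by
        rw [abs_sub_comm (q k i j)]
        exact abs_sub_le _ _ _
      have hq := ihq i j
      refine lt_of_le_of_lt (htri.trans (add_le_add hcc hq)) ?_
      set w := K / (B - 1) with hw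
      have e1 : K * L * α ^ k / (B - 1) = L * α ^ k * w := by rw [hw]; ring
      have e2 : K * L * α ^ (k + 1) / (B - 1) = L * α ^ k * (α * w) := by rw [hw, pow_succ]; ring
      rw [e1, e2, pow_succ]
      have key : s * (1 + α) + w < K * α - α * w := by
        have : K * α = K * w + K * σ := by rw [hα]; ring
        have h1 : s * α < s := mul_lt_of_lt_one_right hs0 hαlt
        have h2 : α * w < w := mul_lt_of_lt_one_left hw0 hαlt
        have h3 : 2 * w < K * w := mul_lt_mul_of_pos_right hK2 hw0
        linarith
      have hLP : 0 < L * α ^ k := by positivity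
      have := mul_lt_mul_of_pos_left key hLP
      linarith
  refine ⟨hαlt, ?_, ?_⟩
  · rw [div_le_iff₀ (by linarith)]
    have : 4 * κ * (1 / (4 * κ)) = 1 := by field_simp
    have h1 : 4 * κ * (1 / (4 * κ)) ≤ 4 * κ * (1 - α) :=
      mul_le_mul_of_nonneg_left (by linarith) (by positivity)
    linarith
  · intro ε hε k hk
    refine (hmain k).1.trans ?_
    have h1 : α ≤ Real.exp (-(1 / (4 * κ))) := by
      have := Real.add_one_le_exp (-(1 / (4 * κ)))
      linarith
    have h2 : α ^ k ≤ Real.exp (-Real.log (s / ε)) := by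
      refine (pow_le_pow_left₀ hα0.le h1 k).trans ?_
      rw [← Real.exp_nat_mul]
      apply Real.exp_le_exp.2
      have h3 : Real.log (s / ε) ≤ k / (4 * κ) := by
        rw [le_div_iff₀ (by positivity)]; linarith
      have e : (k : ℝ) * -(1 / (4 * κ)) = -(k / (4 * κ)) := by ring
      rw [e]; linarith
    rw [Real.exp_neg, Real.exp_log (by positivity), inv_div] at h2
    calc α ^ k * s ≤ ε / s * s := by gcongr
      _ = ε := by field_simp
end
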